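/- Fix integers m ≥ p ≥ 1, a matrix X ∈ ℝ^{m×p} of full column rank p with rows x₁ᵀ, …, x_mᵀ, and z ∈ ℝ^m. Set τ² = 8 and θ = 0 (the case r = 1/2). For y ∈ (0,∞)^m let D(y) be the m×m diagonal matrix with i-th diagonal entry (τ² yᵢ)⁻¹, let Σ(y) = (Xᵀ D(y) X)⁻¹ and μ(y) = Σ(y) Xᵀ D(y) z, and let π(β | y, z) be the p-variate normal density with mean μ(y) and covariance Σ(y) evaluated at β ∈ ℝ^p. For β ∈ ℝ^p let π(y | β, z) = ∏_{i=1}^m √(α/(2π)) · exp(√α |zᵢ − xᵢᵀβ|/τ) · yᵢ^{−1/2} · exp(−(α yᵢ + (zᵢ − xᵢᵀβ)²/(τ² yᵢ))/2) with α = (2τ² + θ²)/τ² = 2, which is a probability density on (0,∞)^m. Then ∫_{(0,∞)^m} ∫_{ℝ^p} π(β | y, z) π(y | β, z) dβ dy < ∞. -/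

import Mathlib

open MeasureTheory Matrix

namespace BQR

variable {m p : ℕ}

/-- The diagonal matrix `D(y)` with `i`-th diagonal entry `(τ² yᵢ)⁻¹ = (8 yᵢ)⁻¹`
(the case `r = 1/2`, `τ² = 8`). -/
noncomputable def Dmat (y : Fin m → ℝ) : Matrix (Fin m) (Fin m) ℝ :=
  Matrix.diagonal fun i => (8 * y i)⁻¹

/-- The precision matrix `Σ(y)⁻¹ = Xᵀ D(y) X`. -/
noncomputable def prec (X : Matrix (Fin m) (Fin p) ℝ) (y : Fin m → ℝ) :
    Matrix (Fin p) (Fin p) ℝ :=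
  Xᵀ * Dmat y * X

/-- The conditional mean `μ(y) = Σ(y) Xᵀ D(y) z` (with `θ = 0`). -/
noncomputable def muVec (X : Matrix (Fin m) (Fin p) ℝ) (z : Fin m → ℝ)
    (y : Fin m → ℝ) : Fin p → ℝ :=
  (prec X y)⁻¹ *ᵥ ((Xᵀ * Dmat y) *ᵥ z)

/-- `π(β | y, z)`: the `p`-variate normal density with mean `μ(y)` and covariance
`Σ(y) = (Xᵀ D(y) X)⁻¹`, evaluated at `β`. -/
noncomputable def condBeta (X : Matrix (Fin m) (Fin p) ℝ) (z : Fin m → ℝ)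
    (y : Fin m → ℝ) (β : Fin p → ℝ) : ℝ :=
  (2 * Real.pi) ^ (-(p : ℝ) / 2) * Real.sqrt (prec X y).det *
    Real.exp (-(1 / 2) * ((β - muVec X z y) ⬝ᵥ (prec X y *ᵥ (β - muVec X z y))))

/-- `π(y | β, z)`: with `τ² = 8`, `θ = 0`, `α = (2τ² + θ²)/τ² = 2`, the product over `i` of
`√(α/(2π)) exp(√α |zᵢ − xᵢᵀβ|/τ) yᵢ^{-1/2} exp(−(α yᵢ + (zᵢ − xᵢᵀβ)²/(τ² yᵢ))/2)`. -/
noncomputable def condY (X : Matrix (Fin m) (Fin p) ℝ) (z : Fin m → ℝ)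
    (β : Fin p → ℝ) (y : Fin m → ℝ) : ℝ :=
  ∏ i, Real.sqrt (2 / (2 * Real.pi)) *
    Real.exp (Real.sqrt 2 * |z i - (X *ᵥ β) i| / Real.sqrt 8) *
    (y i) ^ (-(1 : ℝ) / 2) *
    Real.exp (-(2 * y i + (z i - (X *ᵥ β) i) ^ 2 / (8 * y i)) / 2)

end BQR

namespace BQR

lemma inj_of_rank {m p : ℕ} (X : Matrix (Fin m) (Fin p) ℝ) (hrank : X.rank = p) :
    Function.Injective X.mulVec := by
  have h : LinearIndependent ℝ X.col := by
    rw [linearIndependent_iff_card_eq_finrank_span, Set.finrank, ← Matrix.rank_eq_finrank_span_cols, hrank]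
    simp
  exact Matrix.mulVec_injective_iff.2 h

lemma prec_posDef {m p : ℕ} (X : Matrix (Fin m) (Fin p) ℝ) (hX : Function.Injective X.mulVec)
    (y : Fin m → ℝ) (hy : ∀ i, 0 < y i) : (prec X y).PosDef := by
  have hD : (Dmat y).PosDef := by
    unfold Dmat
    refine Matrix.posDef_diagonal_iff.2 fun i => ?_
    have := hy i
    positivity
  have := hD.conjTranspose_mul_mul_same hX
  simpa [prec, Matrix.conjTranspose_eq_transpose_of_trivial] using this

lemma quad_eq {m p : ℕ} (X : Matrix (Fin m) (Fin p) ℝ) (y : Fin m → ℝ) (v : Fin p → ℝ) :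
    v ⬝ᵥ (prec X y *ᵥ v) = ∑ i, (8 * y i)⁻¹ * (X *ᵥ v) i ^ 2 := by
  unfold prec Dmat
  rw [← Matrix.mulVec_mulVec, ← Matrix.mulVec_mulVec, Matrix.dotProduct_mulVec,
    Matrix.vecMul_transpose]
  simp only [dotProduct, Matrix.mulVec_diagonal]
  refine Finset.sum_congr rfl fun i _ => by ring

lemma normal_eq {m p : ℕ} (X : Matrix (Fin m) (Fin p) ℝ) (hX : Function.Injective X.mulVec)
    (z y : Fin m → ℝ) (hy : ∀ i, 0 < y i) (v : Fin p → ℝ) :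
    ∑ i, (8 * y i)⁻¹ * (z i - (X *ᵥ muVec X z y) i) * (X *ᵥ v) i = 0 := by
  have hu : IsUnit (prec X y).det := (prec_posDef X hX y hy).det_pos.ne'.isUnit
  have h1 : prec X y *ᵥ muVec X z y = (Xᵀ * Dmat y) *ᵥ z := by
    unfold muVec
    rw [Matrix.mulVec_mulVec, Matrix.mul_nonsing_inv _ hu, Matrix.one_mulVec]
  have h2 : v ⬝ᵥ ((Xᵀ * Dmat y) *ᵥ (z - X *ᵥ muVec X z y)) = 0 := by
    rw [Matrix.mulVec_sub, Matrix.mulVec_mulVec]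
    change v ⬝ᵥ (_ - prec X y *ᵥ _) = 0
    rw [h1, sub_self, dotProduct_zero]
  rw [← Matrix.mulVec_mulVec, Matrix.dotProduct_mulVec, Matrix.vecMul_transpose] at h2
  unfold Dmat at h2
  simp only [dotProduct, Matrix.mulVec_diagonal, Pi.sub_apply] at h2
  rw [← h2]
  refine Finset.sum_congr rfl fun i _ => by ring

lemma mu_bound {m p : ℕ} (X : Matrix (Fin m) (Fin p) ℝ) (hX : Function.Injective X.mulVec)
    (z : Fin m → ℝ) : ∃ C : ℝ, ∀ y : Fin m → ℝ, (∀ i, 0 < y i) → ‖muVec X z y‖ ≤ C := by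
  by_contra! hcon
  choose y hy hn using fun n : ℕ => hcon ((n : ℝ) + 1)
  set u : ℕ → (Fin p → ℝ) := fun n => muVec X z (y n) with hu
  have hpos : ∀ n, 0 < ‖u n‖ := fun n => lt_trans (by positivity) (hn n)
  have hsph : ∀ n, ‖u n‖⁻¹ • u n ∈ Metric.sphere (0 : Fin p → ℝ) 1 := fun n => by
    simp [norm_smul, (hpos n).ne']
  obtain ⟨v, hv, φ, hφ, hlim⟩ := (isCompact_sphere (0 : Fin p → ℝ) 1).tendsto_subseq hsph
  have hXv : X *ᵥ v ≠ 0 := by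
    intro h
    have : v = 0 := hX (by simpa using h)
    simp [this] at hv
  have hinv : Filter.Tendsto (fun n => ‖u (φ n)‖⁻¹) Filter.atTop (nhds 0) := by
    apply Filter.Tendsto.comp tendsto_inv_atTop_zero
    refine Filter.tendsto_atTop_mono (f := fun n : ℕ => (n : ℝ)) (fun n => ?_) tendsto_natCast_atTop_atTop
    have h1 := hn (φ n)
    have h2 : (n : ℝ) ≤ φ n := by exact_mod_cast hφ.id_le n
    linarith
  have hlim2 : ∀ i, Filter.Tendsto (fun n => ‖u (φ n)‖⁻¹ * (z i - (X *ᵥ u (φ n)) i) * (X *ᵥ v) i)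
      Filter.atTop (nhds (-((X *ᵥ v) i) ^ 2)) := by
    intro i
    have hc : Continuous fun w : Fin p → ℝ => (X *ᵥ w) i := by fun_prop
    have h1 := (hc.tendsto v).comp hlim
    have h2 := ((hinv.mul_const (z i)).sub h1).mul_const ((X *ᵥ v) i)
    refine (h2.congr fun n => ?_).trans (by rw [zero_mul, zero_sub, neg_mul, ← sq])
    simp only [Function.comp_apply, Matrix.mulVec_smul, Pi.smul_apply, smul_eq_mul]
    ring
  have hev : ∀ᶠ n in Filter.atTop, ∀ i, (X *ᵥ v) i ≠ 0 →
      ‖u (φ n)‖⁻¹ * (z i - (X *ᵥ u (φ n)) i) * (X *ᵥ v) i < 0 := by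
    rw [Filter.eventually_all]
    intro i
    by_cases h : (X *ᵥ v) i = 0
    · simp [h]
    · have : -((X *ᵥ v) i) ^ 2 < 0 := by have := sq_pos_of_ne_zero h; linarith
      filter_upwards [(hlim2 i).eventually_lt_const this] with n hn _ using hn
  obtain ⟨n, hn'⟩ := hev.exists
  have hN := normal_eq X hX z (y (φ n)) (hy _) v
  have : ∑ i, (8 * y (φ n) i)⁻¹ * (z i - (X *ᵥ muVec X z (y (φ n))) i) * (X *ᵥ v) i < 0 := by
    obtain ⟨j, hj⟩ := Function.ne_iff.1 hXv
    have key : ∀ i, (X *ᵥ v) i ≠ 0 →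
        (8 * y (φ n) i)⁻¹ * (z i - (X *ᵥ muVec X z (y (φ n))) i) * (X *ᵥ v) i < 0 := by
      intro i hi
      have h1 := hn' i hi
      have h2 : (z i - (X *ᵥ u (φ n)) i) * (X *ᵥ v) i < 0 := by
        rw [mul_assoc] at h1
        exact (pos_iff_neg_of_mul_neg h1).1 (inv_pos.2 (hpos _))
      have h3 := hy (φ n) i
      rw [mul_assoc]
      exact mul_neg_of_pos_of_neg (by positivity) h2
    refine Finset.sum_neg' (fun i _ => ?_) ⟨j, Finset.mem_univ _, key j hj⟩
    by_cases h : (X *ᵥ v) i = 0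
    · simp [h]
    · exact (key i h).le
  linarith

open scoped MatrixOrder Matrix.Norms.L2Operator in
lemma gauss {p : ℕ} (P : Matrix (Fin p) (Fin p) ℝ) (hP : P.PosDef) (μ : Fin p → ℝ) :
    ENNReal.ofReal (Real.sqrt P.det) *
      ∫⁻ β : Fin p → ℝ, ENNReal.ofReal (Real.exp (-(1/4) * ((β - μ) ⬝ᵥ (P *ᵥ (β - μ))))) =
    ∫⁻ v : Fin p → ℝ, ENNReal.ofReal (Real.exp (-(1/4) * (v ⬝ᵥ v))) := by
  obtain ⟨A, hA⟩ : ∃ A : Matrix (Fin p) (Fin p) ℝ, P = Aᵀ * A := by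
    obtain ⟨A, hA⟩ := CStarAlgebra.nonneg_iff_eq_star_mul_self.mp hP.posSemidef.nonneg
    exact ⟨A, by simpa [Matrix.star_eq_conjTranspose, Matrix.conjTranspose_eq_transpose_of_trivial] using hA⟩
  have hdet : P.det = A.det ^ 2 := by rw [hA, Matrix.det_mul, Matrix.det_transpose, sq]
  have hA0 : A.det ≠ 0 := by
    intro h
    have := hP.det_pos
    rw [hdet, h] at this
    simp at this
  rw [lintegral_sub_right_eq_self (fun β : Fin p → ℝ => ENNReal.ofReal (Real.exp (-(1/4) * (β ⬝ᵥ (P *ᵥ β))))) μ]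
  have h1 : ∀ β : Fin p → ℝ, β ⬝ᵥ (P *ᵥ β) = (Matrix.toLin' A β) ⬝ᵥ (Matrix.toLin' A β) := by
    intro β
    rw [hA, ← Matrix.mulVec_mulVec, Matrix.dotProduct_mulVec, Matrix.vecMul_transpose]
    simp
  simp_rw [h1]
  have hm : Measurable fun v : Fin p → ℝ => ENNReal.ofReal (Real.exp (-(1/4) * (v ⬝ᵥ v))) := by
    unfold dotProduct
    fun_prop
  rw [← lintegral_map (μ := volume) hm (LinearMap.continuous_of_finiteDimensional (Matrix.toLin' A)).measurable,
    Real.map_matrix_volume_pi_eq_smul_volume_pi hA0, lintegral_smul_measure, smul_eq_mul,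
    ← mul_assoc, ← ENNReal.ofReal_mul (by positivity), hdet, Real.sqrt_sq_eq_abs, ← abs_mul,
    mul_inv_cancel₀ hA0]
  simp

lemma gauss_fin (p : ℕ) :
    ∫⁻ v : Fin p → ℝ, ENNReal.ofReal (Real.exp (-(1/4) * (v ⬝ᵥ v))) < ⊤ := by
  have h : Integrable (fun v : Fin p → ℝ => ∏ i, Real.exp (-(1/4) * v i ^ 2)) :=
    Integrable.fintype_prod (f := fun _ x => Real.exp (-(1/4) * x ^ 2)) fun i => integrable_exp_neg_mul_sq (by norm_num)
  have h2 := h.lintegral_lt_top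
  simpa [← Real.exp_sum, dotProduct, Finset.mul_sum, sq] using h2

lemma y_fin (m : ℕ) :
    ∫⁻ y in Set.univ.pi fun _ : Fin m => Set.Ioi (0 : ℝ),
      ENNReal.ofReal (∏ i, (y i) ^ (-(1 : ℝ) / 2) * Real.exp (-(1/3) * y i)) < ⊤ := by
  have h : Integrable (fun y : Fin m → ℝ => ∏ i, (y i) ^ (-(1 : ℝ) / 2) * Real.exp (-(1/3) * y i))
      (Measure.pi fun _ => volume.restrict (Set.Ioi (0:ℝ))) := by
    refine Integrable.fintype_prod (f := fun _ x => x ^ (-(1 : ℝ) / 2) * Real.exp (-(1/3) * x)) fun i => ?_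
    have := integrableOn_rpow_mul_exp_neg_mul_rpow (p := 1) (s := -(1:ℝ)/2) (b := 1/3) (by norm_num) (by norm_num) (by norm_num)
    simpa [IntegrableOn] using this
  rw [← Measure.restrict_pi_pi] at h
  exact h.lintegral_lt_top

lemma pointwise {m p : ℕ} (X : Matrix (Fin m) (Fin p) ℝ) (hX : Function.Injective X.mulVec)
    (z : Fin m → ℝ) (C : ℝ) (y : Fin m → ℝ) (hy : ∀ i, 0 < y i)
    (hC : ∀ i, |z i - (X *ᵥ muVec X z y) i| ≤ C) (β : Fin p → ℝ) :
    condBeta X z y β * condY X z β y ≤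
      ((2 * Real.pi) ^ (-(p : ℝ) / 2) * (Real.sqrt (2 / (2 * Real.pi)) ^ m * Real.exp (m * (C / 2)))) *
      (∏ i, (y i) ^ (-(1 : ℝ) / 2) * Real.exp (-(1/3) * y i)) *
      (Real.sqrt (prec X y).det *
        Real.exp (-(1/4) * ((β - muVec X z y) ⬝ᵥ (prec X y *ᵥ (β - muVec X z y))))) := by
  have h8 : Real.sqrt 8 = 2 * Real.sqrt 2 := by
    rw [show (8:ℝ) = 2 ^ 2 * 2 by norm_num, Real.sqrt_mul (by norm_num), Real.sqrt_sq (by norm_num)]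
  have h2 : 0 < Real.sqrt 2 := by positivity
  unfold condBeta condY
  simp only [Finset.prod_mul_distrib, Finset.prod_const, Finset.card_univ, Fintype.card_fin,
    ← Real.exp_sum]
  set μ := muVec X z y with hμ
  set Y := ∏ i, (y i) ^ (-(1 : ℝ) / 2) with hY
  have hY0 : 0 ≤ Y := Finset.prod_nonneg fun i _ => Real.rpow_nonneg (hy i).le _
  set w : Fin m → ℝ := X *ᵥ (β - μ) with hw
  set r : Fin m → ℝ := fun i => z i - (X *ᵥ μ) i with hr
  have he : ∀ i, z i - (X *ᵥ β) i = r i - w i := by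
    intro i
    simp [hr, hw, Matrix.mulVec_sub]
  have hN : ∑ i, (8 * y i)⁻¹ * r i * w i = 0 := normal_eq X hX z y hy (β - μ)
  rw [quad_eq]
  simp_rw [he]
  have hexp : -(1/2) * ∑ i, (8 * y i)⁻¹ * w i ^ 2 + (∑ i, Real.sqrt 2 * |r i - w i| / Real.sqrt 8
      + ∑ i, -(2 * y i + (r i - w i) ^ 2 / (8 * y i)) / 2) ≤
      m * (C / 2) + ∑ i, -(1/3) * y i + -(1/4) * ∑ i, (8 * y i)⁻¹ * w i ^ 2 := by
    have hm : (m : ℝ) * (C / 2) = ∑ i : Fin m, C / 2 := by simp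
    rw [hm]
    have : ∀ i, -(1/2) * ((8 * y i)⁻¹ * w i ^ 2) + (Real.sqrt 2 * |r i - w i| / Real.sqrt 8
      + -(2 * y i + (r i - w i) ^ 2 / (8 * y i)) / 2) ≤
      C / 2 + -(1/3) * y i + -(1/4) * ((8 * y i)⁻¹ * w i ^ 2) + (8 * y i)⁻¹ * r i * w i := by
      intro i
      have hyi := hy i
      have e1 : Real.sqrt 2 * |r i - w i| / Real.sqrt 8 = |r i - w i| / 2 := by
        rw [h8]; field_simp
      have e2 : |r i - w i| ≤ C + |w i| := (abs_sub _ _).trans (by linarith [hC i])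
      have e3 : |w i| / 2 ≤ 3 / 4 * ((8 * y i)⁻¹ * w i ^ 2) + 2 / 3 * y i := by
        have : 3 / 4 * ((8 * y i)⁻¹ * w i ^ 2) + 2 / 3 * y i - |w i| / 2
            = 3 / 32 * (|w i| - 8 / 3 * y i) ^ 2 / y i := by
          rw [← sq_abs (w i)]; field_simp; ring
        have h0 : 0 ≤ 3 / 32 * (|w i| - 8 / 3 * y i) ^ 2 / y i := by positivity
        linarith
      have e4 : (r i - w i) ^ 2 / (8 * y i) = (8 * y i)⁻¹ * r i ^ 2
          - 2 * ((8 * y i)⁻¹ * r i * w i) + (8 * y i)⁻¹ * w i ^ 2 := by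
        field_simp; ring
      have e5 : 0 ≤ (8 * y i)⁻¹ * r i ^ 2 := by positivity
      rw [e1, e4]
      linarith
    have hs := Finset.sum_le_sum fun i (_ : i ∈ Finset.univ) => this i
    simp only [Finset.sum_add_distrib, ← Finset.mul_sum] at hs ⊢
    linarith
  have hexp' := Real.exp_le_exp.2 hexp
  simp only [Real.exp_add] at hexp'
  have hK : 0 ≤ (2 * Real.pi) ^ (-(p : ℝ) / 2) * Real.sqrt (2 / (2 * Real.pi)) ^ m * Y *
    Real.sqrt (prec X y).det := by positivity
  refine le_trans (le_of_eq ?_) ((mul_le_mul_of_nonneg_left hexp' hK).trans (le_of_eq ?_))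
  · ring
  · ring

end BQR

theorem stmt13 (m p : ℕ) (hp : 1 ≤ p) (hpm : p ≤ m)
    (X : Matrix (Fin m) (Fin p) ℝ) (hrank : X.rank = p) (z : Fin m → ℝ) :
    (∫⁻ y in Set.univ.pi fun _ : Fin m => Set.Ioi (0 : ℝ),
      ∫⁻ β : Fin p → ℝ,
        ENNReal.ofReal (BQR.condBeta X z y β * BQR.condY X z β y) ∂volume ∂volume)
      < ⊤ := by
  have hX := BQR.inj_of_rank X hrank
  obtain ⟨C, hC⟩ := BQR.mu_bound X hX z
  obtain ⟨C', hC'⟩ : ∃ C', ∀ y : Fin m → ℝ, (∀ i, 0 < y i) →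
      ∀ i, |z i - (X *ᵥ BQR.muVec X z y) i| ≤ C' := by
    have hc : Continuous fun v : Fin p → ℝ => z - X *ᵥ v := by fun_prop
    obtain ⟨C', h⟩ := (isCompact_closedBall (0 : Fin p → ℝ) C).exists_bound_of_continuousOn hc.continuousOn
    refine ⟨C', fun y hy i => ?_⟩
    have h1 := h (BQR.muVec X z y) (by simpa using hC y hy)
    exact (norm_le_pi_norm (z - X *ᵥ BQR.muVec X z y) i).trans h1
  set K := ((2 * Real.pi) ^ (-(p : ℝ) / 2) * (Real.sqrt (2 / (2 * Real.pi)) ^ m * Real.exp (m * (C' / 2)))) with hK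
  have hK0 : 0 ≤ K := by positivity
  set G := ∫⁻ v : Fin p → ℝ, ENNReal.ofReal (Real.exp (-(1/4) * (v ⬝ᵥ v))) with hG
  have hms : MeasurableSet (Set.univ.pi fun _ : Fin m => Set.Ioi (0 : ℝ)) :=
    MeasurableSet.univ_pi fun _ => measurableSet_Ioi
  have hle : ∀ y ∈ (Set.univ.pi fun _ : Fin m => Set.Ioi (0 : ℝ)),
      ∫⁻ β : Fin p → ℝ, ENNReal.ofReal (BQR.condBeta X z y β * BQR.condY X z β y) ≤
      (ENNReal.ofReal K * G) *
        ENNReal.ofReal (∏ i, (y i) ^ (-(1 : ℝ) / 2) * Real.exp (-(1/3) * y i)) := by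
    intro y hy
    have hy' : ∀ i, 0 < y i := fun i => hy i (Set.mem_univ i)
    have hY0 : 0 ≤ ∏ i, (y i) ^ (-(1 : ℝ) / 2) * Real.exp (-(1/3) * y i) :=
      Finset.prod_nonneg fun i _ => mul_nonneg (Real.rpow_nonneg (hy' i).le _) (Real.exp_pos _).le
    refine (lintegral_mono fun β => ENNReal.ofReal_le_ofReal
      (BQR.pointwise X hX z C' y hy' (hC' y hy') β)).trans (le_of_eq ?_)
    simp_rw [← hK, ENNReal.ofReal_mul (mul_nonneg hK0 hY0), ENNReal.ofReal_mul (Real.sqrt_nonneg _)]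
    rw [lintegral_const_mul' _ _ ENNReal.ofReal_ne_top, lintegral_const_mul' _ _ ENNReal.ofReal_ne_top,
      BQR.gauss _ (BQR.prec_posDef X hX y hy'), ENNReal.ofReal_mul hK0]
    ring
  refine (setLIntegral_mono' hms hle).trans_lt ?_
  rw [lintegral_const_mul' _ _ (ENNReal.mul_ne_top ENNReal.ofReal_ne_top (BQR.gauss_fin p).ne)]
  exact ENNReal.mul_lt_top (ENNReal.mul_lt_top ENNReal.ofReal_lt_top (BQR.gauss_fin p)) (BQR.y_fin m)
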